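/- Let n ≥ 6 and let G be a connected graph on n vertices with κ̄_n(G) = 1 and e(G) = C(n−1, 2) + 1. Then G is the graph K_{n−1} + K₁, i.e., a complete graph on n − 1 vertices together with one additional vertex joined to it by a single edge. -/

import Mathlib

open SimpleGraph

/-- An `S`-Steiner tree in `G`: a subgraph that is a tree and contains `S`. -/
def SimpleGraph.IsSteinerTree {V : Type*} (G : SimpleGraph V) (S : Set V)
    (T : G.Subgraph) : Prop :=
  S ⊆ T.verts ∧ T.coe.IsTree

/-- `κ(S)`: the maximum number of pairwise internally disjoint `S`-Steiner trees in `G`. -/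
noncomputable def SimpleGraph.steinerConn {V : Type*} (G : SimpleGraph V) (S : Set V) : ℕ :=
  sSup {n : ℕ | ∃ f : Fin n → G.Subgraph,
    (∀ i, G.IsSteinerTree S (f i)) ∧
    ∀ i j, i ≠ j →
      (f i).edgeSet ∩ (f j).edgeSet = ∅ ∧ (f i).verts ∩ (f j).verts = S}

/-- `κ̄ₖ(G) = max {κ(S) : S ⊆ V(G), |S| = k}`, the maximal generalized local connectivity. -/
noncomputable def SimpleGraph.kappaBar {V : Type*} (G : SimpleGraph V) (k : ℕ) : ℕ :=
  sSup {m : ℕ | ∃ S : Finset V, S.card = k ∧ G.steinerConn ↑S = m}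

/-- `p` is an ear of the cycle `c` in `G`: a nontrivial path (whose two endpoints may
coincide) meeting `c` exactly in its endpoints. -/
def SimpleGraph.IsEar {V : Type*} (G : SimpleGraph V) {x u v : V}
    (c : G.Walk x x) (p : G.Walk u v) : Prop :=
  0 < p.length ∧ u ∈ c.support ∧ v ∈ c.support ∧
  p.support.tail.Nodup ∧ (u = v ∨ u ∉ p.support.tail) ∧
  ∀ w ∈ p.support, w ∈ c.support → w = u ∨ w = v


open Finset in
/-- The number of neighbours of `v` in `H` that lie in `s`. -/
noncomputable def SimpleGraph.degIn {V : Type*} (H : SimpleGraph V) (s : Finset V) (v : V) : ℕ :=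
  by classical exact #{w ∈ s | H.Adj v w}

/-- The sum of the degrees of the subgraph of `H` induced on `s`. -/
noncomputable def SimpleGraph.degSum {V : Type*} (H : SimpleGraph V) (s : Finset V) : ℕ :=
  ∑ v ∈ s, H.degIn s v

/-- `G` contains two edge-disjoint graphs on the vertex set `s`, each connecting `s`. -/
def SimpleGraph.HasTwoConnectors {V : Type*} (G : SimpleGraph V) (s : Finset V) : Prop :=
  ∃ A B : SimpleGraph V, A ≤ G ∧ B ≤ G ∧ (∀ x y, A.Adj x y → ¬ B.Adj x y) ∧
    (∀ x y, A.Adj x y → x ∈ s) ∧ (∀ x y, B.Adj x y → x ∈ s) ∧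
    (∀ x ∈ s, ∀ y ∈ s, A.Reachable x y) ∧ (∀ x ∈ s, ∀ y ∈ s, B.Reachable x y)

namespace SimpleGraph

variable {V : Type*} {G H : SimpleGraph V} {s : Finset V}

lemma degSum_eq_zero_iff : H.degSum s = 0 ↔ ∀ x ∈ s, ∀ y ∈ s, ¬ H.Adj x y := by
  classical
  simp [degSum, degIn, Finset.filter_eq_empty_iff]

lemma degIn_erase_le [DecidableEq V] (v w : V) : H.degIn (s.erase v) w ≤ H.degIn s w := by
  classical
  exact Finset.card_le_card (Finset.filter_subset_filter _ (Finset.erase_subset _ _))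

lemma degIn_erase_add [DecidableEq V] {v : V} (hv : v ∈ s) (w : V) [Decidable (H.Adj w v)] :
    H.degIn s w = H.degIn (s.erase v) w + if H.Adj w v then 1 else 0 := by
  classical
  unfold degIn
  conv_lhs => rw [← Finset.insert_erase hv, Finset.filter_insert]
  split_ifs with h
  · rw [Finset.card_insert_of_notMem (by simp)]
  · rfl

lemma degSum_erase [DecidableEq V] {v : V} (hv : v ∈ s) :
    H.degSum s = H.degSum (s.erase v) + 2 * H.degIn s v := by
  classical
  have h1 : H.degSum s = H.degIn s v + ∑ w ∈ s.erase v, H.degIn s w :=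
    (Finset.add_sum_erase _ _ hv).symm
  have h2 : ∑ w ∈ s.erase v, H.degIn s w = H.degSum (s.erase v) + H.degIn s v := by
    simp_rw [degIn_erase_add hv, Finset.sum_add_distrib]
    have h3 : H.degIn (s.erase v) v = ∑ w ∈ s.erase v, if H.Adj w v then 1 else 0 := by
      simp [degIn, adj_comm]
    simp [degSum, h3]
  omega

lemma two_mul_degIn_le {v : V} (hv : v ∈ s) : 2 * H.degIn s v ≤ H.degSum s := by
  classical
  rw [degSum_erase hv]
  omega

lemma exists_degIn_pos (h : H.degSum s ≠ 0) : ∃ v ∈ s, 0 < H.degIn s v := by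
  obtain ⟨v, hv, h⟩ := Finset.exists_ne_zero_of_sum_ne_zero h
  exact ⟨v, hv, Nat.pos_of_ne_zero h⟩

lemma exists_adj_of_degIn_pos {v : V} (h : 0 < H.degIn s v) : ∃ w ∈ s, H.Adj v w := by
  classical
  obtain ⟨w, hw⟩ := Finset.card_pos.1 h
  exact ⟨w, by simpa using hw⟩

lemma eq_of_degIn_le_one {v x y : V} (h : H.degIn s v ≤ 1) (hx : x ∈ s) (hy : y ∈ s)
    (hvx : H.Adj v x) (hvy : H.Adj v y) : x = y := by
  classical
  exact Finset.card_le_one.1 h x (by simp [hx, hvx]) y (by simp [hy, hvy])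

/-- Two connectors extend to a new vertex with two neighbours in the old vertex set. -/
lemma HasTwoConnectors.insert_vertex [DecidableEq V] {v x y : V} (h : G.HasTwoConnectors s) (hv : v ∉ s)
    (hx : x ∈ s) (hy : y ∈ s) (hxy : x ≠ y) (hvx : G.Adj v x) (hvy : G.Adj v y) :
    G.HasTwoConnectors (insert v s) := by
  obtain ⟨A, B, hA, hB, hAB, hAs, hBs, hAr, hBr⟩ := h
  have ext : ∀ (A : SimpleGraph V) (x : V), x ∈ s → v ≠ x →
      (∀ x ∈ s, ∀ y ∈ s, A.Reachable x y) →
      ∀ a ∈ insert v s, ∀ b ∈ insert v s, (A ⊔ edge v x).Reachable a b := by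
    intro A x hx hne hr
    have key : ∀ a ∈ insert v s, (A ⊔ edge v x).Reachable a x := by
      intro a ha
      rcases Finset.mem_insert.1 ha with rfl | ha
      · exact Adj.reachable (by simp [edge_adj, hne])
      · exact (hr a ha x hx).mono le_sup_left
    exact fun a ha b hb => (key a ha).trans (key b hb).symm
  refine ⟨A ⊔ edge v x, B ⊔ edge v y, ?_, ?_, ?_, ?_, ?_, ext A x hx hvx.ne hAr,
    ext B y hy hvy.ne hBr⟩
  · exact sup_le hA ((edge_le_iff _).2 (.inr hvx))
  · exact sup_le hB ((edge_le_iff _).2 (.inr hvy))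
  · intro a b
    have hA1 := hAs v
    have hA2 := fun a h => hAs v a (A.adj_symm h)
    have hB1 := hBs v
    have hB2 := fun a h => hBs v a (B.adj_symm h)
    have := hAB a b
    simp only [sup_adj, edge_adj]
    grind
  · intro a b hab
    simp only [sup_adj, edge_adj] at hab
    grind
  · intro a b hab
    simp only [sup_adj, edge_adj] at hab
    grind

lemma HasTwoConnectors.of_erase [DecidableEq V] {v : V} (hv : v ∈ s)
    (hd : H.degIn s v + 3 ≤ s.card) (h : Hᶜ.HasTwoConnectors (s.erase v)) :
    Hᶜ.HasTwoConnectors s := by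
  classical
  have hc : 1 < ((s.erase v).filter (fun w => ¬ H.Adj v w)).card := by
    have h1 := Finset.card_filter_add_card_filter_not (s := s.erase v) (fun w => H.Adj v w)
    have h2 : ((s.erase v).filter (fun w => H.Adj v w)).card ≤ H.degIn s v :=
      degIn_erase_le v v
    rw [Finset.card_erase_of_mem hv] at h1
    omega
  obtain ⟨x, hx, y, hy, hxy⟩ := Finset.one_lt_card.1 hc
  simp only [Finset.mem_filter] at hx hy
  have hx' := (Finset.mem_erase.1 hx.1).1
  have hy' := (Finset.mem_erase.1 hy.1).1
  rw [← Finset.insert_erase hv]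
  exact h.insert_vertex (by simp) hx.1 hy.1 hxy ⟨hx'.symm, hx.2⟩ ⟨hy'.symm, hy.2⟩

lemma hasTwoConnectors_of_card_eq_four (hs : s.card = 4) (hD : H.degSum s = 0) :
    Hᶜ.HasTwoConnectors s := by
  classical
  rw [degSum_eq_zero_iff] at hD
  obtain ⟨a, b, c, d, hab, hac, had, hbc, hbd, hcd, rfl⟩ := Finset.card_eq_four.1 hs
  have hG : ∀ x ∈ ({a, b, c, d} : Finset V), ∀ y ∈ ({a, b, c, d} : Finset V), x ≠ y →
    Hᶜ.Adj x y := fun x hx y hy h => ⟨h, hD x hx y hy⟩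
  simp only [Finset.mem_insert, Finset.mem_singleton] at hG
  have conn : ∀ (A : SimpleGraph V) (a b c d : V), A.Adj a b → A.Adj b c → A.Adj c d →
      ∀ x, (x = a ∨ x = b ∨ x = c ∨ x = d) → A.Reachable a x := by
    rintro A a b c d h1 h2 h3 x (rfl | rfl | rfl | rfl)
    · rfl
    · exact h1.reachable
    · exact h1.reachable.trans h2.reachable
    · exact (h1.reachable.trans h2.reachable).trans h3.reachable
  refine ⟨fromEdgeSet {s(a, b), s(b, c), s(c, d)}, fromEdgeSet {s(b, d), s(d, a), s(a, c)},
    ?_, ?_, ?_, ?_, ?_, ?_, ?_⟩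
  · intro x y; simp only [fromEdgeSet_adj, Set.mem_insert_iff, Set.mem_singleton_iff, Sym2.eq_iff]
    grind
  · intro x y; simp only [fromEdgeSet_adj, Set.mem_insert_iff, Set.mem_singleton_iff, Sym2.eq_iff]
    grind
  · intro x y; simp only [fromEdgeSet_adj, Set.mem_insert_iff, Set.mem_singleton_iff, Sym2.eq_iff]
    grind
  · intro x y; simp only [fromEdgeSet_adj, Set.mem_insert_iff, Set.mem_singleton_iff, Sym2.eq_iff]
    grind
  · intro x y; simp only [fromEdgeSet_adj, Set.mem_insert_iff, Set.mem_singleton_iff, Sym2.eq_iff]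
    grind
  · have := conn (fromEdgeSet {s(a, b), s(b, c), s(c, d)}) a b c d (by simp [hab]) (by simp [hbc])
      (by simp [hcd])
    intro x hx y hy
    exact (this x (by grind)).symm.trans (this y (by grind))
  · have := conn (fromEdgeSet {s(b, d), s(d, a), s(a, c)}) b d a c (by simp [hbd])
      (by simp [had.symm]) (by simp [hac])
    intro x hx y hy
    exact (this x (by grind)).symm.trans (this y (by grind))

/-- The complete graph on five vertices minus two disjoint edges contains two connectors. -/
lemma hasTwoConnectors_of_five [DecidableEq V] {a b c d e : V}
    (hac : G.Adj a c) (had : G.Adj a d) (hae : G.Adj a e) (hbc : G.Adj b c) (hbd : G.Adj b d)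
    (hbe : G.Adj b e) (hce : G.Adj c e) (hde : G.Adj d e) (hab : a ≠ b) (hcd : c ≠ d) :
    G.HasTwoConnectors {a, b, c, d, e} := by
  have conn : ∀ (A : SimpleGraph V) (a b c d e : V),
      A.Adj a b → A.Adj b c → A.Adj c d → A.Adj d e →
      ∀ x, (x = a ∨ x = b ∨ x = c ∨ x = d ∨ x = e) → A.Reachable a x := by
    rintro A a b c d e h1 h2 h3 h4 x (rfl | rfl | rfl | rfl | rfl)
    · rfl
    · exact h1.reachable
    · exact h1.reachable.trans h2.reachable
    · exact (h1.reachable.trans h2.reachable).trans h3.reachable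
    · exact ((h1.reachable.trans h2.reachable).trans h3.reachable).trans h4.reachable
  have := hac.ne
  have := had.ne
  have := hae.ne
  have := hbc.ne
  have := hbd.ne
  have := hbe.ne
  have := hce.ne
  have := hde.ne
  refine ⟨fromEdgeSet {s(a, c), s(c, b), s(b, e), s(e, d)},
    fromEdgeSet {s(b, d), s(d, a), s(a, e), s(e, c)}, ?_, ?_, ?_, ?_, ?_, ?_, ?_⟩
  · intro x y; simp only [fromEdgeSet_adj, Set.mem_insert_iff, Set.mem_singleton_iff, Sym2.eq_iff]
    grind [adj_comm]
  · intro x y; simp only [fromEdgeSet_adj, Set.mem_insert_iff, Set.mem_singleton_iff, Sym2.eq_iff]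
    grind [adj_comm]
  · intro x y; simp only [fromEdgeSet_adj, Set.mem_insert_iff, Set.mem_singleton_iff, Sym2.eq_iff]
    grind
  · intro x y; simp only [fromEdgeSet_adj, Set.mem_insert_iff, Set.mem_singleton_iff, Sym2.eq_iff]
    grind
  · intro x y; simp only [fromEdgeSet_adj, Set.mem_insert_iff, Set.mem_singleton_iff, Sym2.eq_iff]
    grind
  · have := conn (fromEdgeSet {s(a, c), s(c, b), s(b, e), s(e, d)}) a c b e d
      (by simp [*]) (by simp [hbc.ne']) (by simp [*]) (by simp [hde.ne'])
    intro x hx y hy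
    exact (this x (by grind)).symm.trans (this y (by grind))
  · have := conn (fromEdgeSet {s(b, d), s(d, a), s(a, e), s(e, c)}) b d a e c
      (by simp [*]) (by simp [had.ne']) (by simp [*]) (by simp [hce.ne'])
    intro x hx y hy
    exact (this x (by grind)).symm.trans (this y (by grind))

lemma hasTwoConnectors_of_card_eq_five (hs : s.card = 5) (hD : H.degSum s ≤ 4) :
    Hᶜ.HasTwoConnectors s := by
  classical
  obtain ⟨a, ha, hmax⟩ := s.exists_max_image (H.degIn s) (Finset.card_pos.1 (by omega))
  have hDa := degSum_erase (H := H) ha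
  have hca : (s.erase a).card = 4 := by rw [Finset.card_erase_of_mem ha, hs]
  by_cases h0 : H.degSum (s.erase a) = 0
  · exact .of_erase ha (by omega) (hasTwoConnectors_of_card_eq_four hca h0)
  obtain ⟨c, hc, hcpos⟩ := exists_degIn_pos h0
  have hcs := Finset.mem_of_mem_erase hc
  have hle : ∀ v ∈ s, H.degIn s v ≤ 1 := fun v hv => (hmax v hv).trans (by omega)
  have hapos : 0 < H.degIn s a :=
    (hcpos.trans_le (degIn_erase_le a c)).trans_le (hmax c hcs)
  obtain ⟨b, hb, hab⟩ := exists_adj_of_degIn_pos hapos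
  obtain ⟨d, hd, hcd⟩ := exists_adj_of_degIn_pos hcpos
  have hds := Finset.mem_of_mem_erase hd
  have hca' := (Finset.mem_erase.1 hc).1
  have hda' := (Finset.mem_erase.1 hd).1
  have uniq : ∀ v ∈ s, ∀ x ∈ s, ∀ y ∈ s, H.Adj v x → H.Adj v y → x = y :=
    fun v hv x hx y hy => eq_of_degIn_le_one (hle v hv) hx hy
  have hbc : b ≠ c := by
    rintro rfl
    exact hda' (uniq b hb d hds a ha hcd hab.symm)
  have hbd : b ≠ d := by
    rintro rfl
    exact hca' (uniq b hb c hcs a ha hcd.symm hab.symm)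
  have hsub : ({a, b, c, d} : Finset V) ⊆ s := by
    simp [Finset.insert_subset_iff, *]
  have hc4 : ({a, b, c, d} : Finset V).card = 4 :=
    Finset.card_eq_four.2 ⟨a, b, c, d, hab.ne, hca'.symm, hda'.symm, hbc, hbd, hcd.ne, rfl⟩
  obtain ⟨e, he⟩ := Finset.card_eq_one.1
    (show (s \ {a, b, c, d}).card = 1 by rw [Finset.card_sdiff_of_subset hsub]; omega)
  have hse : s = {a, b, c, d, e} := by
    have := Finset.sdiff_union_of_subset hsub
    rw [he] at this
    rw [← this]
    grind
  have hes : e ∈ s ∧ e ∉ ({a, b, c, d} : Finset V) := by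
    rw [← Finset.mem_sdiff, he]
    simp
  obtain ⟨hes, hen⟩ := hes
  simp only [Finset.mem_insert, Finset.mem_singleton, not_or] at hen
  obtain ⟨hea, heb, hec, hed⟩ := hen
  have hG : ∀ v ∈ s, ∀ w ∈ s, H.Adj v w → ∀ x ∈ s, x ≠ v → x ≠ w → Hᶜ.Adj v x :=
    fun v hv w hw h x hx h1 h2 => ⟨h1.symm, fun h' => h2 (uniq v hv x hx w hw h' h)⟩
  have hGa := hG a ha b hb hab
  have hGb := hG b hb a ha hab.symm
  have hGc := hG c hcs d hds hcd
  have hGd := hG d hds c hcs hcd.symm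
  rw [hse]
  exact hasTwoConnectors_of_five (hGa c hcs hca' hbc.symm) (hGa d hds hda' hbd.symm)
    (hGa e hes hea heb) (hGb c hcs hbc.symm hca') (hGb d hds hbd.symm hda') (hGb e hes heb hea)
    (hGc e hes hec hed) (hGd e hes hed hec) hab.ne hcd.ne

lemma hasTwoConnectors_of_card_eq_six (hs : s.card = 6) (hD : H.degSum s ≤ 8)
    (hdeg : ∀ v ∈ s, H.degIn s v ≤ 3) : Hᶜ.HasTwoConnectors s := by
  classical
  obtain ⟨a, ha, hmax⟩ := s.exists_max_image (H.degIn s) (Finset.card_pos.1 (by omega))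
  have hDa := degSum_erase (H := H) ha
  have hda := hdeg a ha
  have hsum : H.degSum s ≤ s.card * H.degIn s a := by
    simpa [degSum] using Finset.sum_le_card_nsmul s _ _ hmax
  rw [hs] at hsum
  exact .of_erase ha (by omega)
    (hasTwoConnectors_of_card_eq_five (by rw [Finset.card_erase_of_mem ha, hs]) (by omega))

/-- The complement of a graph with at most `n - 2` edges and maximum degree at most `n - 3` on
`n ≥ 6` vertices contains two connectors. -/
lemma hasTwoConnectors_of_degSum_le (hs : 6 ≤ s.card) (hD : H.degSum s + 4 ≤ 2 * s.card)
    (hdeg : ∀ v ∈ s, H.degIn s v + 3 ≤ s.card) : Hᶜ.HasTwoConnectors s := by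
  classical
  obtain ⟨n, hn⟩ : ∃ n, s.card = n := ⟨_, rfl⟩
  have h6 : 6 ≤ n := hn ▸ hs
  induction n, h6 using Nat.le_induction generalizing s with
  | base =>
    exact hasTwoConnectors_of_card_eq_six hn (by omega)
      fun v hv => by have := hdeg v hv; omega
  | succ n h6 ih =>
    suffices ∃ v ∈ s, (0 < H.degIn s v ∨ H.degSum s = 0) ∧
        ∀ w ∈ s.erase v, H.degIn (s.erase v) w + 3 ≤ n by
      obtain ⟨v, hv, hpos, hw⟩ := this
      have hc : (s.erase v).card = n := by rw [Finset.card_erase_of_mem hv]; omega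
      have := degSum_erase (H := H) hv
      exact .of_erase hv (hdeg v hv) (ih (by omega) (by omega) (by simpa only [hc] using hw) hc)
    by_cases hbig : ∃ u ∈ s, H.degIn s u + 3 = n + 1
    · obtain ⟨u, hu, hun⟩ := hbig
      obtain ⟨v, hv, huv⟩ := exists_adj_of_degIn_pos (show 0 < H.degIn s u by omega)
      refine ⟨v, hv, .inl (Finset.card_pos.2 ⟨u, by simp [hu, huv.symm]⟩), fun w hw => ?_⟩
      rw [Finset.mem_erase] at hw
      by_cases hwu : w = u
      · subst hwu
        have := degIn_erase_add (H := H) hv w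
        rw [if_pos huv] at this
        omega
      · have h1 := degSum_erase (H := H) hu
        have h2 := two_mul_degIn_le (H := H) (Finset.mem_erase.2 ⟨hwu, hw.2⟩)
        have h3 := degIn_erase_add (H := H) hu w
        have h4 := degIn_erase_le (H := H) (s := s) v w
        split_ifs at h3 <;> omega
    · push Not at hbig
      have hlt : ∀ v, ∀ w ∈ s.erase v, H.degIn (s.erase v) w + 3 ≤ n := by
        intro v w hw
        have hws := Finset.mem_of_mem_erase hw
        have h1 := hdeg w hws
        have h2 := hbig w hws
        have h3 := degIn_erase_le (H := H) (s := s) v w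
        omega
      by_cases h0 : H.degSum s = 0
      · obtain ⟨v, hv⟩ := Finset.card_pos.1 (show 0 < s.card by omega)
        exact ⟨v, hv, .inr h0, hlt v⟩
      · obtain ⟨v, hv, hpos⟩ := exists_degIn_pos h0
        exact ⟨v, hv, .inl hpos, hlt v⟩

lemma kappaBar_card [Fintype V] : G.kappaBar (Fintype.card V) = G.steinerConn Set.univ := by
  have : {m : ℕ | ∃ S : Finset V, S.card = Fintype.card V ∧ G.steinerConn ↑S = m} =
      {G.steinerConn Set.univ} := by
    ext m
    simp [Finset.card_eq_iff_eq_univ, eq_comm]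
  rw [kappaBar, this, csSup_singleton]

lemma isSteinerTree_toSubgraph {T : SimpleGraph V} (hT : T.IsTree) (hle : T ≤ G) :
    G.IsSteinerTree Set.univ (toSubgraph T hle) := by
  refine ⟨subset_rfl, ?_⟩
  let f : T ≃g (toSubgraph T hle).coe :=
    ⟨(Equiv.Set.univ V).symm, by intro a b; simp [Equiv.Set.univ]; rfl⟩
  exact f.isTree_iff.1 hT

lemma not_hasTwoConnectors_univ [Fintype V] [Nonempty V] (hk : G.steinerConn Set.univ = 1) :
    ¬ G.HasTwoConnectors Finset.univ := by
  rintro ⟨A, B, hA, hB, hAB, -, -, hAr, hBr⟩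
  have hAc : A.Connected := ⟨fun x y => hAr x (Finset.mem_univ x) y (Finset.mem_univ y)⟩
  have hBc : B.Connected := ⟨fun x y => hBr x (Finset.mem_univ x) y (Finset.mem_univ y)⟩
  obtain ⟨S, hSA, hS⟩ := hAc.exists_isTree_le
  obtain ⟨T, hTB, hT⟩ := hBc.exists_isTree_le
  have hdisj : ∀ e ∈ S.edgeSet, e ∉ T.edgeSet := by
    intro e
    induction e with
    | h x y => exact fun h1 h2 => hAB x y (hSA h1) (hTB h2)
  set N := {n : ℕ | ∃ f : Fin n → G.Subgraph,
    (∀ i, G.IsSteinerTree Set.univ (f i)) ∧ ∀ i j, i ≠ j →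
      (f i).edgeSet ∩ (f j).edgeSet = ∅ ∧ (f i).verts ∩ (f j).verts = Set.univ} with hN
  have hk' : sSup N = 1 := hk
  have hbdd : BddAbove N := by
    by_contra h
    rw [Nat.sSup_of_not_bddAbove h] at hk'
    exact zero_ne_one hk'
  have h2 : 2 ∈ N := by
    refine ⟨![toSubgraph S (hSA.trans hA), toSubgraph T (hTB.trans hB)], ?_, ?_⟩
    · intro i
      fin_cases i
      · exact isSteinerTree_toSubgraph hS _
      · exact isSteinerTree_toSubgraph hT _
    · have hS' : (toSubgraph S (hSA.trans hA)).edgeSet = S.edgeSet := by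
        ext e; induction e with | h x y => rfl
      have hT' : (toSubgraph T (hTB.trans hB)).edgeSet = T.edgeSet := by
        ext e; induction e with | h x y => rfl
      have hST : S.edgeSet ∩ T.edgeSet = ∅ :=
        Set.disjoint_iff_inter_eq_empty.1 (Set.disjoint_left.2 hdisj)
      intro i j hij
      fin_cases i <;> fin_cases j
      · exact absurd rfl hij
      · simp [hS', hT', hST]
      · simp [hS', hT', Set.inter_comm, hST]
      · exact absurd rfl hij
  have := le_csSup hbdd h2
  omega

lemma degSum_compl_univ [Fintype V] :
    Gᶜ.degSum Finset.univ + 2 * G.edgeSet.ncard = Fintype.card V * (Fintype.card V - 1) := by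
  classical
  have h1 : Gᶜ.degSum Finset.univ = ∑ v, Gᶜ.degree v := by
    refine Finset.sum_congr rfl fun v _ => ?_
    unfold degIn
    rw [← card_neighborFinset_eq_degree]
    congr 1
    ext w
    simp
  have h2 : 2 * G.edgeSet.ncard = ∑ v, G.degree v := by
    rw [sum_degrees_eq_twice_card_edges, ← coe_edgeFinset, Set.ncard_coe_finset]
  rw [h1, h2, ← Finset.sum_add_distrib]
  have h3 : ∀ v ∈ (Finset.univ : Finset V), Gᶜ.degree v + G.degree v = Fintype.card V - 1 := by
    intro v _
    have := G.degree_lt_card_verts v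
    rw [degree_compl]
    omega
  rw [Finset.sum_congr rfl h3]
  simp

end SimpleGraph

/-- For `n ≥ 6`, a connected graph on `n` vertices with `κ̄ₙ(G) = 1` and
exactly `C(n-1, 2) + 1` edges is `K_{n-1} + K₁`: some vertex `v` has exactly one neighbour,
and all the remaining vertices are pairwise adjacent. -/
theorem stmt_15 {V : Type*} [Fintype V] (G : SimpleGraph V) (hn : 6 ≤ Fintype.card V)
    (hG : G.Connected) (hk : G.kappaBar (Fintype.card V) = 1)
    (he : G.edgeSet.ncard = (Fintype.card V - 1).choose 2 + 1) :
    ∃ v : V, (∀ a b : V, a ≠ v → b ≠ v → a ≠ b → G.Adj a b) ∧ (∃! w : V, G.Adj v w) := by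
  classical
  have : Nonempty V := hG.nonempty
  have hno := not_hasTwoConnectors_univ (kappaBar_card.symm.trans hk)
  have hD : Gᶜ.degSum Finset.univ + 4 = 2 * Fintype.card V := by
    have h := G.degSum_compl_univ
    obtain ⟨m, hm⟩ : ∃ m, Fintype.card V = m + 2 := ⟨_, (Nat.sub_add_cancel (by omega)).symm⟩
    rw [he, hm] at h
    have hch : 2 * (m + 1).choose 2 = (m + 1) * m := by
      have := Finset.sum_range_id_mul_two (m + 1)
      rw [Finset.sum_range_id, ← Nat.choose_two_right] at this
      simpa [mul_comm] using this
    simp only [Nat.add_succ_sub_one, mul_add, hch] at h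
    rw [hm]
    nlinarith
  obtain ⟨v, hv⟩ : ∃ v, Fintype.card V < Gᶜ.degIn Finset.univ v + 3 := by
    by_contra! hcon
    apply hno
    rw [← compl_compl G]
    exact hasTwoConnectors_of_degSum_le (by simpa using hn) (by simpa using hD.le)
      fun v _ => by simpa using hcon v
  have hDv := degSum_erase (H := Gᶜ) (Finset.mem_univ v)
  have h0 : Gᶜ.degSum (Finset.univ.erase v) = 0 := by omega
  rw [degSum_eq_zero_iff] at h0
  refine ⟨v, fun a b ha hb hab => ?_, ?_⟩
  · have := h0 a (by simp [ha]) b (by simp [hb])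
    simpa [hab] using this
  · have : Nontrivial V := Fintype.one_lt_card_iff_nontrivial.1 (by omega)
    obtain ⟨w, hw⟩ := hG.preconnected.exists_adj_of_nontrivial v
    refine ⟨w, hw, fun y hy => ?_⟩
    by_contra hne
    have hsub : Finset.univ.filter (fun x => Gᶜ.Adj v x) ⊆ Finset.univ \ {v, w, y} := by
      intro x hx
      simp only [Finset.mem_filter, compl_adj] at hx
      simp only [Finset.mem_sdiff, Finset.mem_insert, Finset.mem_singleton]
      grind
    have hle : Gᶜ.degIn Finset.univ v ≤ (Finset.univ \ {v, w, y}).card := by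
      unfold degIn
      convert Finset.card_le_card hsub
    rw [Finset.card_sdiff_of_subset (Finset.subset_univ _), Finset.card_univ,
      Finset.card_eq_three.2 ⟨v, w, y, hw.ne, hy.ne, Ne.symm hne, rfl⟩] at hle
    omega
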